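/- Retarded maximal estimate for the low-frequency part (estimate (est-nhmax0)): there exists C>0 such that for every T ∈ (0,1] and every Schwartz function f on ℝ×ℝ³, ( ∫_ℝ ( sup_{(y,z)∈ℝ², t∈[0,T]} | ∫₀^t U(t−t') P₀ f(t',·) dt' (x,y,z) | )² dx )^{1/2} ≤ C ∫_ℝ ( ∫₀^T ∫_{ℝ²} |P₀f(t,x,y,z)|² dy dz dt )^{1/2} dx. -/

import Mathlib

open MeasureTheory Real Filter
open scoped ENNReal

noncomputable section

/-- Euclidean dot product on ℝ³ (realized as ℝ × ℝ × ℝ). -/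
def dot3 (a b : ℝ × ℝ × ℝ) : ℝ := a.1 * b.1 + a.2.1 * b.2.1 + a.2.2 * b.2.2

/-- Euclidean norm on ℝ³. -/
def en3 (ξ : ℝ × ℝ × ℝ) : ℝ := Real.sqrt (dot3 ξ ξ)

/-- The Zakharov–Kuznetsov dispersion relation ω(ξ,η,μ) = ξ(ξ²+η²+μ²). -/
def omega3 (ξ : ℝ × ℝ × ℝ) : ℝ := ξ.1 * (ξ.1 ^ 2 + ξ.2.1 ^ 2 + ξ.2.2 ^ 2)

/-- Fourier transform on ℝ³, with normalization (2π)⁻³ ∫ e^{-i x·ξ} φ(x) dx. -/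
def FT3 (φ : ℝ × ℝ × ℝ → ℂ) (ξ : ℝ × ℝ × ℝ) : ℂ :=
  ((((2 * π) ^ 3)⁻¹ : ℝ) : ℂ) * ∫ x : ℝ × ℝ × ℝ, Complex.exp (-Complex.I * (dot3 x ξ : ℂ)) * φ x

/-- Inverse Fourier transform on ℝ³: ∫ e^{i x·ξ} g(ξ) dξ. -/
def invFT3 (g : ℝ × ℝ × ℝ → ℂ) (x : ℝ × ℝ × ℝ) : ℂ :=
  ∫ ξ : ℝ × ℝ × ℝ, Complex.exp (Complex.I * (dot3 x ξ : ℂ)) * g ξ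

/-- The free Zakharov–Kuznetsov evolution U(t)φ(x̄) = ∫ e^{i(x̄·ξ̄ + tω(ξ̄))} φ̂(ξ̄) dξ̄. -/
def U3 (φ : ℝ × ℝ × ℝ → ℂ) (t : ℝ) (x : ℝ × ℝ × ℝ) : ℂ :=
  ∫ ξ : ℝ × ℝ × ℝ, Complex.exp (Complex.I * ((dot3 x ξ + t * omega3 ξ : ℝ) : ℂ)) * FT3 φ ξ

/-- L² norm on ℝ³. -/
def L2norm3 (φ : ℝ × ℝ × ℝ → ℂ) : ℝ := Real.sqrt (∫ x : ℝ × ℝ × ℝ, ‖φ x‖ ^ 2)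

/-- j-th coordinate of a point of ℝ³. -/
def coord3 (j : Fin 3) (ξ : ℝ × ℝ × ℝ) : ℝ := ![ξ.1, ξ.2.1, ξ.2.2] j

/-- Littlewood–Paley ring cutoff δ_k(ξ̄) = p(2^{-k-1}ξ̄) − p(2^{-k}ξ̄) on ℝ³. -/
def delta3 (p : ℝ × ℝ × ℝ → ℝ) (k : ℤ) (ξ : ℝ × ℝ × ℝ) : ℝ :=
  p ((2:ℝ) ^ (-k-1) • ξ) - p ((2:ℝ) ^ (-k) • ξ)

/-- 1D rescaled cutoff p_k(ξ) = p(2^{-k}ξ). -/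
def pk1 (p : ℝ → ℝ) (k : ℤ) (ξ : ℝ) : ℝ := p ((2:ℝ) ^ (-k) * ξ)

/-- 1D ring cutoff δ_k(ξ) = p(2^{-k-1}ξ) − p(2^{-k}ξ). -/
def dk1 (p : ℝ → ℝ) (k : ℤ) (ξ : ℝ) : ℝ := p ((2:ℝ) ^ (-k-1) * ξ) - p ((2:ℝ) ^ (-k) * ξ)

/-- Oscillatory integral I with three 1D symbols:
I(t,x̄) = ∫ e^{i(x̄·ξ̄+tω(ξ̄))} ψ₁(ξ)ψ₂(η)ψ₃(μ) dξ̄. -/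
def oscI (ψ₁ ψ₂ ψ₃ : ℝ → ℝ) (t : ℝ) (x : ℝ × ℝ × ℝ) : ℂ :=
  ∫ ξ : ℝ × ℝ × ℝ, Complex.exp (Complex.I * ((dot3 x ξ + t * omega3 ξ : ℝ) : ℂ)) *
    ((ψ₁ ξ.1 * ψ₂ ξ.2.1 * ψ₃ ξ.2.2 : ℝ) : ℂ)

/-- Duhamel term with a Fourier multiplier m applied:
∫₀^t (m(D) U(t-t') f(t',·))(x̄) dt', computed on the frequency side. -/
def duhamel (m : ℝ × ℝ × ℝ → ℂ) (f : ℝ × (ℝ × ℝ × ℝ) → ℂ) (t : ℝ) (x : ℝ × ℝ × ℝ) : ℂ :=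
  ∫ s in (0:ℝ)..t, ∫ ξ : ℝ × ℝ × ℝ,
    Complex.exp (Complex.I * ((dot3 x ξ + (t - s) * omega3 ξ : ℝ) : ℂ)) * m ξ *
      FT3 (fun w => f (s, w)) ξ

/-- Euclidean dot product on ℝ⁴ (time and space). -/
def dot4 (a b : ℝ × ℝ × ℝ × ℝ) : ℝ := a.1 * b.1 + dot3 a.2 b.2

/-- The integrable weight `(1 + x²)⁻¹`. -/
def dec (x : ℝ) : ℝ := (1 + x ^ 2)⁻¹

/-- Tensor product of three copies of `dec`. -/
def dec3 (v : ℝ × ℝ × ℝ) : ℝ := dec v.1 * (dec v.2.1 * dec v.2.2)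

lemma dec_pos (x : ℝ) : 0 < dec x := by unfold dec; positivity

lemma dec_le_one (x : ℝ) : dec x ≤ 1 := by
  unfold dec; exact inv_le_one_of_one_le₀ (by nlinarith [sq_nonneg x])

@[fun_prop]
lemma continuous_dec : Continuous dec := by
  unfold dec
  exact (by fun_prop : Continuous fun x : ℝ => 1 + x ^ 2).inv₀ fun x => by positivity

lemma integrable_dec : Integrable dec := integrable_inv_one_add_sq

lemma dec3_pos (v : ℝ × ℝ × ℝ) : 0 < dec3 v :=
  mul_pos (dec_pos _) (mul_pos (dec_pos _) (dec_pos _))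

@[fun_prop]
lemma continuous_dec3 : Continuous dec3 := by unfold dec3; fun_prop

lemma integrable_dec3 : Integrable dec3 :=
  integrable_dec.mul_prod (integrable_dec.mul_prod integrable_dec)

lemma inv_sq_le_dec {x R : ℝ} (hR : 1 ≤ R) (hx : |x| ≤ R) : (R ^ 2)⁻¹ ≤ 2 * dec x := by
  have h1 : x ^ 2 ≤ R ^ 2 := sq_le_sq' (by linarith [neg_abs_le x]) ((le_abs_self x).trans hx)
  have h2 : 1 ≤ R ^ 2 := one_le_pow₀ hR
  unfold dec
  rw [← div_eq_mul_inv, inv_eq_one_div, div_le_div_iff₀ (by positivity) (by positivity)]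
  linarith

lemma inv_pow_le_dec {v : ℝ × ℝ × ℝ × ℝ} {R : ℝ} (hR : 1 ≤ R) (h1 : |v.1| ≤ R)
    (h2 : |v.2.1| ≤ R) (h3 : |v.2.2.1| ≤ R) (h4 : |v.2.2.2| ≤ R) :
    (R ^ 16)⁻¹ ≤ 2 ^ 8 * (dec v.1 * dec3 v.2) ^ 2 := by
  have hR0 : 0 < R := by linarith
  have e : (R ^ 16)⁻¹ = ((R ^ 2)⁻¹ * ((R ^ 2)⁻¹ * ((R ^ 2)⁻¹ * (R ^ 2)⁻¹))) ^ 2 := by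
    field_simp
  have e2 : 2 ^ 8 * (dec v.1 * dec3 v.2) ^ 2 =
      ((2 * dec v.1) * ((2 * dec v.2.1) * ((2 * dec v.2.2.1) * (2 * dec v.2.2.2)))) ^ 2 := by
    unfold dec3; ring
  rw [e, e2]
  have p1 := dec_pos v.1
  have p2 := dec_pos v.2.1
  have p3 := dec_pos v.2.2.1
  have p4 := dec_pos v.2.2.2
  gcongr <;> exact inv_sq_le_dec hR (by assumption)

/-- ℝ⁴ with its Euclidean structure, as an iterated `L²` product. -/
abbrev Euc4 : Type := WithLp 2 (ℝ × WithLp 2 (ℝ × WithLp 2 (ℝ × ℝ)))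

/-- The identification of ℝ × ℝ × ℝ × ℝ with Euclidean ℝ⁴. -/
def toEuc4 (v : ℝ × ℝ × ℝ × ℝ) : Euc4 :=
  WithLp.toLp 2 (v.1, WithLp.toLp 2 (v.2.1, WithLp.toLp 2 v.2.2))

/-- The inverse of `toEuc4`. -/
def ofEuc4 (w : Euc4) : ℝ × ℝ × ℝ × ℝ :=
  ((WithLp.ofLp w).1, (WithLp.ofLp (WithLp.ofLp w).2).1,
    WithLp.ofLp (WithLp.ofLp (WithLp.ofLp w).2).2)

lemma ofEuc4_toEuc4 (v : ℝ × ℝ × ℝ × ℝ) : ofEuc4 (toEuc4 v) = v := rfl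

lemma toEuc4_ofEuc4 (w : Euc4) : toEuc4 (ofEuc4 w) = w := rfl

lemma measurePreserving_toEuc4 : MeasurePreserving toEuc4 := by
  have h1 := WithLp.volume_preserving_toLp ℝ ℝ
  have h2 := (WithLp.volume_preserving_toLp ℝ (WithLp 2 (ℝ × ℝ))).comp
    ((MeasurePreserving.id (volume : Measure ℝ)).prod h1)
  exact (WithLp.volume_preserving_toLp ℝ (WithLp 2 (ℝ × WithLp 2 (ℝ × ℝ)))).comp
    ((MeasurePreserving.id (volume : Measure ℝ)).prod h2)

lemma continuous_toEuc4 : Continuous toEuc4 := by unfold toEuc4; fun_prop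

lemma contDiff_ofEuc4 : ContDiff ℝ (⊤ : ℕ∞) ofEuc4 := by
  have h1 := (WithLp.prodContinuousLinearEquiv 2 ℝ ℝ ℝ).contDiff (n := (⊤ : ℕ∞))
  have h2 := (WithLp.prodContinuousLinearEquiv 2 ℝ ℝ (WithLp 2 (ℝ × ℝ))).contDiff
    (n := (⊤ : ℕ∞))
  have h3 := (WithLp.prodContinuousLinearEquiv 2 ℝ ℝ
    (WithLp 2 (ℝ × WithLp 2 (ℝ × ℝ)))).contDiff (n := (⊤ : ℕ∞))
  exact h3.fst.prodMk ((h2.comp h3.snd).fst.prodMk (h1.comp (h2.comp h3.snd).snd))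

lemma continuous_ofEuc4 : Continuous ofEuc4 := contDiff_ofEuc4.continuous

/-- `toEuc4` as a homeomorphism. -/
def homeoEuc4 : (ℝ × ℝ × ℝ × ℝ) ≃ₜ Euc4 where
  toFun := toEuc4
  invFun := ofEuc4
  left_inv := ofEuc4_toEuc4
  right_inv := toEuc4_ofEuc4
  continuous_toFun := continuous_toEuc4
  continuous_invFun := continuous_ofEuc4

lemma integral_toEuc4 (F : Euc4 → ℂ) : ∫ w, F w = ∫ v, F (toEuc4 v) :=
  (measurePreserving_toEuc4.integral_comp homeoEuc4.measurableEmbedding F).symm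

lemma inner_toEuc4 (a b : ℝ × ℝ × ℝ × ℝ) : inner ℝ (toEuc4 a) (toEuc4 b) = dot4 a b := by
  simp [toEuc4, WithLp.prod_inner_apply, dot4, dot3]
  ring

lemma dot4_comm (a b : ℝ × ℝ × ℝ × ℝ) : dot4 a b = dot4 b a := by unfold dot4 dot3; ring

lemma abs_le_norm_toEuc4 (v : ℝ × ℝ × ℝ × ℝ) : |v.1| ≤ ‖toEuc4 v‖ ∧ |v.2.1| ≤ ‖toEuc4 v‖ ∧
    |v.2.2.1| ≤ ‖toEuc4 v‖ ∧ |v.2.2.2| ≤ ‖toEuc4 v‖ := by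
  have h : ‖toEuc4 v‖ ^ 2 = v.1 ^ 2 + (v.2.1 ^ 2 + (v.2.2.1 ^ 2 + v.2.2.2 ^ 2)) := by
    rw [← real_inner_self_eq_norm_sq, inner_toEuc4, dot4, dot3]; ring
  refine ⟨?_, ?_, ?_, ?_⟩ <;> refine abs_le_of_sq_le_sq ?_ (norm_nonneg _) <;> rw [h] <;>
    nlinarith [sq_nonneg v.1, sq_nonneg v.2.1, sq_nonneg v.2.2.1, sq_nonneg v.2.2.2]

instance isAddHaarMeasure_volume_real2 : (volume : Measure (ℝ × ℝ)).IsAddHaarMeasure :=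
  inferInstanceAs (Measure.prod volume volume).IsAddHaarMeasure

instance isAddHaarMeasure_volume_real3 : (volume : Measure (ℝ × ℝ × ℝ)).IsAddHaarMeasure :=
  inferInstanceAs (Measure.prod volume volume).IsAddHaarMeasure

instance isAddHaarMeasure_volume_real4 : (volume : Measure (ℝ × ℝ × ℝ × ℝ)).IsAddHaarMeasure :=
  inferInstanceAs (Measure.prod volume volume).IsAddHaarMeasure

/-- Decay and inversion for the Fourier integral of a test function on ℝ⁴. -/
lemma fourier_testFunction {Φ : ℝ × ℝ × ℝ × ℝ → ℂ} (hΦ : ContDiff ℝ (⊤ : ℕ∞) Φ)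
    (hc : HasCompactSupport Φ) :
    ∃ Ψ : ℝ × ℝ × ℝ × ℝ → ℂ, Continuous Ψ ∧
      (∀ v, Ψ v = ∫ u, Complex.exp (-Complex.I * (dot4 v u : ℂ)) * Φ u) ∧
      (∃ C : ℝ, 0 ≤ C ∧ ∀ v, ‖Ψ v‖ ≤ C * (dec v.1 * dec3 v.2) ^ 2) ∧
      ∃ c : ℂ, ∀ u, Φ u = c * ∫ v, Complex.exp (Complex.I * (dot4 v u : ℂ)) * Ψ v := by
  have hc' : HasCompactSupport (Φ ∘ ofEuc4) := hc.comp_homeomorph homeoEuc4.symm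
  let S : SchwartzMap Euc4 ℂ := hc'.toSchwartzMap (hΦ.comp contDiff_ofEuc4)
  have hS : ∀ v, S (toEuc4 v) = Φ v := fun v => rfl
  let F : SchwartzMap Euc4 ℂ := FourierTransform.fourier S
  have hF : ∀ v, F (toEuc4 v) =
      ∫ u, Complex.exp (-Complex.I * ((2 * π * dot4 v u : ℝ) : ℂ)) * Φ u := by
    intro v
    have : F (toEuc4 v) = FourierTransform.fourier (S : Euc4 → ℂ) (toEuc4 v) := rfl
    rw [this, Real.fourier_eq', integral_toEuc4]
    congr 1; ext u
    rw [inner_toEuc4, hS, smul_eq_mul, dot4_comm]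
    congr 2; push_cast; ring
  have hinv : ∀ u, Φ u =
      ∫ v, Complex.exp (Complex.I * ((2 * π * dot4 v u : ℝ) : ℂ)) * F (toEuc4 v) := by
    intro u
    have h1 : FourierTransformInv.fourierInv F = S := FourierTransform.fourierInv_fourier_eq S
    have h2 : FourierTransformInv.fourierInv (F : Euc4 → ℂ) (toEuc4 u) = Φ u := by
      rw [← SchwartzMap.fourierInv_coe, h1, hS]
    rw [← h2, Real.fourierInv_eq', integral_toEuc4]
    congr 1; ext v
    rw [inner_toEuc4, smul_eq_mul]
    congr 2; push_cast; ring
  have hd : ∀ (v u : ℝ × ℝ × ℝ × ℝ), 2 * π * dot4 ((2 * π)⁻¹ • v) u = dot4 v u := by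
    intro v u
    have : π ≠ 0 := Real.pi_ne_zero
    simp only [dot4, dot3, Prod.smul_fst, Prod.smul_snd, smul_eq_mul]
    field_simp
  refine ⟨fun v => F (toEuc4 ((2 * π)⁻¹ • v)), ?_, ?_, ?_, ?_⟩
  · exact F.continuous.comp (continuous_toEuc4.comp (by fun_prop))
  · intro v
    simp only [hF, hd]
  · have hdec := fun w => SchwartzMap.one_add_le_sup_seminorm_apply (𝕜 := ℝ) (m := (16, 0))
      (k := 16) (n := 0) le_rfl le_rfl F w
    set C₀ := (2:ℝ) ^ 16 *
      ((Finset.Iic (16, 0)).sup fun m : ℕ × ℕ => SchwartzMap.seminorm ℝ m.1 m.2) F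
    have hC₀ : 0 ≤ C₀ := le_trans (by positivity) (hdec 0)
    refine ⟨C₀ * (2 * π) ^ 16 * 2 ^ 8, by positivity, fun v => ?_⟩
    set w := toEuc4 ((2 * π)⁻¹ • v) with hw
    have h := hdec w
    rw [norm_iteratedFDeriv_zero] at h
    have hpi : 1 ≤ 2 * π := by linarith [Real.pi_gt_three]
    have hpi0 : 0 < 2 * π := by positivity
    obtain ⟨h1, h2, h3, h4⟩ := abs_le_norm_toEuc4 ((2 * π)⁻¹ • v)
    have key : ∀ x : ℝ, |(2 * π)⁻¹ * x| ≤ ‖w‖ → |x| ≤ 2 * π * (1 + ‖w‖) := by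
      intro x hx
      rw [abs_mul, abs_of_pos (inv_pos.2 hpi0), inv_mul_le_iff₀ hpi0] at hx
      linarith
    have hb := inv_pow_le_dec (v := v) (R := 2 * π * (1 + ‖w‖))
      (by nlinarith [norm_nonneg w]) (key _ h1) (key _ h2) (key _ h3) (key _ h4)
    have hpos : 0 < (1 + ‖w‖) ^ 16 := by positivity
    calc ‖F w‖ ≤ C₀ * ((1 + ‖w‖) ^ 16)⁻¹ := by
          rw [← div_eq_mul_inv, le_div_iff₀ hpos, mul_comm]; exact h
      _ = C₀ * (2 * π) ^ 16 * ((2 * π * (1 + ‖w‖)) ^ 16)⁻¹ := by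
          rw [mul_pow (2 * π)]; field_simp
      _ ≤ C₀ * (2 * π) ^ 16 * (2 ^ 8 * (dec v.1 * dec3 v.2) ^ 2) := by gcongr
      _ = _ := by ring
  · refine ⟨((|(((2 * π)⁻¹) ^ Module.finrank ℝ (ℝ × ℝ × ℝ × ℝ))⁻¹| : ℝ) : ℂ)⁻¹, fun u => ?_⟩
    have := Measure.integral_comp_smul (volume : Measure (ℝ × ℝ × ℝ × ℝ))
      (fun v => Complex.exp (Complex.I * ((2 * π * dot4 v u : ℝ) : ℂ)) * F (toEuc4 v)) (2 * π)⁻¹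
    simp only [hd] at this
    rw [this, ← hinv u, Complex.real_smul, inv_mul_cancel_left₀]
    have : π ≠ 0 := Real.pi_ne_zero
    simp [this]

lemma dec_neg (x : ℝ) : dec (-x) = dec x := by simp [dec]

lemma dec3_neg (v : ℝ × ℝ × ℝ) : dec3 (-v) = dec3 v := by simp [dec3, dec_neg]

lemma dec3_le_one (v : ℝ × ℝ × ℝ) : dec3 v ≤ 1 := by
  have p2 := dec_pos v.2.1
  have p3 := dec_pos v.2.2
  exact mul_le_one₀ (dec_le_one _) (by positivity)
    (mul_le_one₀ (dec_le_one _) p3.le (dec_le_one _))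

lemma dec_mul_dec_sub_le (x v : ℝ) : dec v * dec (x - v) ≤ 2 * dec x := by
  unfold dec
  rw [← mul_inv, ← div_eq_mul_inv, inv_eq_one_div, div_le_div_iff₀ (by positivity) (by positivity)]
  nlinarith [sq_nonneg (x - 2 * v), sq_nonneg (v * (x - v))]

lemma dec3_mul_dec3_sub_le (x v : ℝ × ℝ × ℝ) : dec3 v * dec3 (x - v) ≤ 8 * dec3 x := by
  have e : dec3 v * dec3 (x - v) = (dec v.1 * dec (x.1 - v.1)) *
      ((dec v.2.1 * dec (x.2.1 - v.2.1)) * (dec v.2.2 * dec (x.2.2 - v.2.2))) := by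
    simp only [dec3, Prod.fst_sub, Prod.snd_sub]; ring
  have e2 : 8 * dec3 x = (2 * dec x.1) * ((2 * dec x.2.1) * (2 * dec x.2.2)) := by
    simp only [dec3]; ring
  have p (x : ℝ) : 0 ≤ dec x := (dec_pos x).le
  have q1 := p x.1
  have q2 := p x.2.1
  have q3 := p x.2.2
  have r1 := mul_nonneg (p v.1) (p (x.1 - v.1))
  have r2 := mul_nonneg (p v.2.1) (p (x.2.1 - v.2.1))
  have r3 := mul_nonneg (p v.2.2) (p (x.2.2 - v.2.2))
  rw [e, e2]
  exact mul_le_mul (dec_mul_dec_sub_le _ _) (mul_le_mul (dec_mul_dec_sub_le _ _)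
    (dec_mul_dec_sub_le _ _) r3 (by positivity)) (mul_nonneg r2 r3) (by positivity)

lemma norm_exp_I_mul (r : ℝ) : ‖Complex.exp (Complex.I * (r : ℂ))‖ = 1 := by
  rw [mul_comm, Complex.norm_exp_ofReal_mul_I]

lemma norm_exp_neg_I_mul (r : ℝ) : ‖Complex.exp (-Complex.I * (r : ℂ))‖ = 1 := by
  rw [neg_mul, ← mul_neg, ← Complex.ofReal_neg, norm_exp_I_mul]

lemma continuous_FT3 {φ : ℝ × ℝ × ℝ → ℂ} (hφ : Integrable φ) : Continuous (FT3 φ) := by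
  unfold FT3
  refine continuous_const.mul (continuous_of_dominated (bound := fun x => ‖φ x‖) ?_ ?_ hφ.norm ?_)
  · intro ξ
    exact (by unfold dot3; fun_prop : Continuous fun x : ℝ × ℝ × ℝ =>
      Complex.exp (-Complex.I * (dot3 x ξ : ℂ))).aestronglyMeasurable.mul hφ.aestronglyMeasurable
  · intro ξ
    filter_upwards with x
    rw [norm_mul, norm_exp_neg_I_mul, one_mul]
  · filter_upwards with x
    unfold dot3; fun_prop

/-- The low-frequency part of `φ`. -/
def lowFreq (p : ℝ × ℝ × ℝ → ℝ) (φ : ℝ × ℝ × ℝ → ℂ) : ℝ × ℝ × ℝ → ℂ :=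
  invFT3 (fun ξ => ((p ξ : ℝ) : ℂ) * FT3 φ ξ)

/-- The convolution kernel of the low-frequency projection. -/
def lowKernel (p : ℝ × ℝ × ℝ → ℝ) (v : ℝ × ℝ × ℝ) : ℂ :=
  ∫ ξ : ℝ × ℝ × ℝ, Complex.exp (Complex.I * (dot3 v ξ : ℂ)) * ((p ξ : ℝ) : ℂ)

lemma lowKernel_decay {p : ℝ × ℝ × ℝ → ℝ} (hp : ContDiff ℝ (⊤ : ℕ∞) p)
    (hc : HasCompactSupport p) :
    Continuous (lowKernel p) ∧ ∃ C : ℝ, 0 ≤ C ∧ ∀ v, ‖lowKernel p v‖ ≤ C * dec3 v ^ 2 := by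
  let r : ContDiffBump (0 : ℝ) := ⟨1, 2, one_pos, one_lt_two⟩
  let Φ : ℝ × ℝ × ℝ × ℝ → ℂ := fun u => ((r u.1 : ℝ) : ℂ) * ((p u.2 : ℝ) : ℂ)
  have hΦ : ContDiff ℝ (⊤ : ℕ∞) Φ := by
    have h1 : ContDiff ℝ (⊤ : ℕ∞) (fun u : ℝ × ℝ × ℝ × ℝ => r u.1) := r.contDiff.comp contDiff_fst
    have h2 : ContDiff ℝ (⊤ : ℕ∞) (fun u : ℝ × ℝ × ℝ × ℝ => p u.2) := hp.comp contDiff_snd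
    exact (Complex.ofRealCLM.contDiff.comp h1).mul (Complex.ofRealCLM.contDiff.comp h2)
  have hcΦ : HasCompactSupport Φ := by
    refine HasCompactSupport.of_support_subset_isCompact
      (r.hasCompactSupport.isCompact.prod hc.isCompact) fun u hu => ?_
    have hu' := (Function.mem_support.1 hu)
    refine ⟨subset_closure ?_, subset_closure ?_⟩ <;> rw [Function.mem_support] <;> intro h0 <;>
      exact hu' (by simp [Φ, h0])
  obtain ⟨Ψ, hcont, hΨ, ⟨C, hC, hdec⟩, -⟩ := fourier_testFunction hΦ hcΦ
  have hr : (∫ τ, ((r τ : ℝ) : ℂ)) ≠ 0 := by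
    rw [integral_complex_ofReal]
    exact_mod_cast (r.integral_pos (μ := volume)).ne'
  have key : ∀ v, lowKernel p v = (∫ τ, ((r τ : ℝ) : ℂ))⁻¹ * Ψ (0, -v) := by
    intro v
    rw [eq_inv_mul_iff_mul_eq₀ hr, hΨ, lowKernel, ← integral_prod_mul]
    congr 1; ext u
    simp only [Φ, dot4, dot3, Prod.fst_neg, Prod.snd_neg]
    rw [mul_left_comm]
    congr 2
    push_cast; ring
  constructor
  · rw [funext key]; fun_prop
  · refine ⟨‖(∫ τ, ((r τ : ℝ) : ℂ))⁻¹‖ * C, by positivity, fun v => ?_⟩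
    rw [key, norm_mul, mul_assoc]
    gcongr
    refine (hdec _).trans ?_
    rw [dec3_neg]
    simp [dec]

lemma lowFreq_eq_convolution {p : ℝ × ℝ × ℝ → ℝ} (hp : Continuous p) (hc : HasCompactSupport p)
    {φ : ℝ × ℝ × ℝ → ℂ} (hφ : Integrable φ) (x : ℝ × ℝ × ℝ) :
    lowFreq p φ x = ((((2 * π) ^ 3)⁻¹ : ℝ) : ℂ) * ∫ w, lowKernel p (x - w) * φ w := by
  have hpi : Integrable (fun ξ => ((p ξ : ℝ) : ℂ)) :=
    (hp.integrable_of_hasCompactSupport hc).ofReal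
  have hI : Integrable (Function.uncurry fun ξ w : ℝ × ℝ × ℝ =>
      Complex.exp (Complex.I * (dot3 (x - w) ξ : ℂ)) * (((p ξ : ℝ) : ℂ) * φ w))
      (volume.prod volume) := by
    refine (hpi.mul_prod hφ).bdd_mul (c := 1)
      (by unfold dot3; fun_prop : Continuous fun q : (ℝ × ℝ × ℝ) × (ℝ × ℝ × ℝ) =>
        Complex.exp (Complex.I * (dot3 (x - q.2) q.1 : ℂ))).aestronglyMeasurable ?_
    filter_upwards with q
    rw [norm_exp_I_mul]
  have h1 : lowFreq p φ x = ((((2 * π) ^ 3)⁻¹ : ℝ) : ℂ) * ∫ ξ, ∫ w,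
      Complex.exp (Complex.I * (dot3 (x - w) ξ : ℂ)) * (((p ξ : ℝ) : ℂ) * φ w) := by
    unfold lowFreq invFT3 FT3
    rw [← integral_const_mul]
    congr 1; ext ξ
    have h2 : (∫ w, Complex.exp (Complex.I * (dot3 (x - w) ξ : ℂ)) * (((p ξ : ℝ) : ℂ) * φ w)) =
        Complex.exp (Complex.I * (dot3 x ξ : ℂ)) * ((p ξ : ℝ) : ℂ) *
          ∫ w, Complex.exp (-Complex.I * (dot3 w ξ : ℂ)) * φ w := by
      rw [← integral_const_mul]
      congr 1; ext w
      have : Complex.exp (Complex.I * (dot3 (x - w) ξ : ℂ)) =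
          Complex.exp (Complex.I * (dot3 x ξ : ℂ)) *
            Complex.exp (-Complex.I * (dot3 w ξ : ℂ)) := by
        rw [← Complex.exp_add]
        congr 1
        simp only [dot3, Prod.fst_sub, Prod.snd_sub]
        push_cast; ring
      rw [this]; ring
    rw [h2]; ring
  rw [h1, integral_integral_swap hI]
  congr 2; ext w
  rw [lowKernel, ← integral_mul_const]
  congr 1; ext ξ; ring

lemma schwartz_decay (f : SchwartzMap (ℝ × ℝ × ℝ × ℝ) ℂ) :
    ∃ C : ℝ, 0 ≤ C ∧ ∀ v, ‖f v‖ ≤ C * dec3 v.2 ^ 2 := by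
  have hdec := fun w => SchwartzMap.one_add_le_sup_seminorm_apply (𝕜 := ℝ) (m := (16, 0))
      (k := 16) (n := 0) le_rfl le_rfl f w
  set C₀ := (2:ℝ) ^ 16 *
    ((Finset.Iic (16, 0)).sup fun m : ℕ × ℕ => SchwartzMap.seminorm ℝ m.1 m.2) f
  have hC₀ : 0 ≤ C₀ := le_trans (by positivity) (hdec 0)
  refine ⟨C₀ * 2 ^ 8, by positivity, fun v => ?_⟩
  have h := hdec v
  rw [norm_iteratedFDeriv_zero] at h
  have n1 := norm_fst_le v
  have n2 := norm_snd_le v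
  have n3 := norm_fst_le v.2
  have n4 := norm_snd_le v.2
  have n5 := norm_fst_le v.2.2
  have n6 := norm_snd_le v.2.2
  rw [Real.norm_eq_abs] at n1 n3 n5 n6
  have hb := inv_pow_le_dec (v := v) (R := 1 + ‖v‖) (by linarith [norm_nonneg v])
    (by linarith) (by linarith) (by linarith) (by linarith)
  have hpos : 0 < (1 + ‖v‖) ^ 16 := by positivity
  have p1 := dec_pos v.1
  have p2 := dec3_pos v.2
  calc ‖f v‖ ≤ C₀ * ((1 + ‖v‖) ^ 16)⁻¹ := by
        rw [← div_eq_mul_inv, le_div_iff₀ hpos, mul_comm]; exact h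
    _ ≤ C₀ * (2 ^ 8 * (dec v.1 * dec3 v.2) ^ 2) := by gcongr
    _ ≤ C₀ * (2 ^ 8 * (1 * dec3 v.2) ^ 2) := by gcongr; exact dec_le_one _
    _ = _ := by ring

lemma integrable_slice {f : ℝ × ℝ × ℝ × ℝ → ℂ} (hf : Continuous f) {C : ℝ} (hC : 0 ≤ C)
    (h : ∀ v, ‖f v‖ ≤ C * dec3 v.2 ^ 2) (s : ℝ) : Integrable fun w => f (s, w) := by
  refine (integrable_dec3.const_mul C).mono'
    (by fun_prop : Continuous fun w => f (s, w)).aestronglyMeasurable ?_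
  filter_upwards with w
  refine (h _).trans ?_
  have := dec3_pos w
  gcongr
  exact pow_le_of_le_one this.le (dec3_le_one w) two_ne_zero

lemma lowFreq_decay {p : ℝ × ℝ × ℝ → ℝ} (hp : ContDiff ℝ (⊤ : ℕ∞) p)
    (hc : HasCompactSupport p) {f : ℝ × ℝ × ℝ × ℝ → ℂ} (hf : Continuous f) {C : ℝ} (hC : 0 ≤ C)
    (h : ∀ v, ‖f v‖ ≤ C * dec3 v.2 ^ 2) :
    Continuous (fun q : ℝ × ℝ × ℝ × ℝ => lowFreq p (fun w => f (q.1, w)) q.2) ∧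
    ∃ C' : ℝ, 0 ≤ C' ∧ ∀ s x, ‖lowFreq p (fun w => f (s, w)) x‖ ≤ C' * dec3 x := by
  obtain ⟨hK, D, hD, hKD⟩ := lowKernel_decay hp hc
  have hsl := integrable_slice hf hC h
  have hform : ∀ s x, lowFreq p (fun w => f (s, w)) x =
      ((((2 * π) ^ 3)⁻¹ : ℝ) : ℂ) * ∫ w, lowKernel p (x - w) * f (s, w) := fun s x =>
    lowFreq_eq_convolution hp.continuous hc (hsl s) x
  have hpt : ∀ s x w, ‖lowKernel p (x - w) * f (s, w)‖ ≤ 8 * D * C * dec3 x * dec3 w := by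
    intro s x w
    have p1 := dec3_pos w
    have p2 := dec3_pos (x - w)
    rw [norm_mul]
    calc _ ≤ (D * dec3 (x - w) ^ 2) * (C * dec3 w ^ 2) :=
          mul_le_mul (hKD _) (h (s, w)) (norm_nonneg _) (by positivity)
      _ = D * C * (dec3 w * dec3 (x - w)) * dec3 w * dec3 (x - w) := by ring
      _ ≤ D * C * (8 * dec3 x) * dec3 w * 1 := by
          have p3 := dec3_pos x
          refine mul_le_mul ?_ (dec3_le_one _) p2.le (by positivity)
          gcongr ?_ * _
          exact mul_le_mul_of_nonneg_left (dec3_mul_dec3_sub_le x w) (by positivity)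
      _ = _ := by ring
  constructor
  · simp only [hform]
    refine continuous_const.mul (continuous_of_dominated
      (bound := fun w => 8 * D * C * 1 * dec3 w) ?_ ?_ (integrable_dec3.const_mul _) ?_)
    · intro q
      exact (by fun_prop : Continuous fun w =>
        lowKernel p (q.2 - w) * f (q.1, w)).aestronglyMeasurable
    · intro q
      filter_upwards with w
      refine (hpt _ _ _).trans ?_
      have p1 := dec3_pos w
      gcongr
      exact dec3_le_one _
    · filter_upwards with w
      fun_prop
  · refine ⟨((2 * π) ^ 3)⁻¹ * (8 * D * C * ∫ w, dec3 w), ?_, fun s x => ?_⟩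
    · have : 0 ≤ ∫ w, dec3 w := integral_nonneg fun w => (dec3_pos w).le
      positivity
    · rw [hform, norm_mul, Complex.norm_real, Real.norm_of_nonneg (by positivity), mul_assoc]
      gcongr
      refine (norm_integral_le_of_norm_le (integrable_dec3.const_mul (8 * D * C * dec3 x))
        (ae_of_all _ (hpt s x))).trans_eq ?_
      rw [integral_const_mul]; ring

/-- Pointwise domination of one time slice of the Duhamel integrand by translates of the
low-frequency part. -/
lemma duhamel_slice_le {p : ℝ × ℝ × ℝ → ℝ} (hp : Continuous p) (hc : HasCompactSupport p)
    {Φ Ψ : ℝ × ℝ × ℝ × ℝ → ℂ} (hΨ : Integrable Ψ) {c : ℂ}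
    (hinv : ∀ u, Φ u = c * ∫ v, Complex.exp (Complex.I * (dot4 v u : ℂ)) * Ψ v)
    (hΦ : ∀ τ ξ, |τ| ≤ 1 → p ξ ≠ 0 → Φ (τ, ξ) = Complex.exp (Complex.I * ((τ * omega3 ξ : ℝ) : ℂ)))
    {φ : ℝ × ℝ × ℝ → ℂ} (hφ : Integrable φ) {τ : ℝ} (hτ : |τ| ≤ 1) (x : ℝ × ℝ × ℝ) :
    ‖∫ ξ : ℝ × ℝ × ℝ, Complex.exp (Complex.I * ((dot3 x ξ + τ * omega3 ξ : ℝ) : ℂ)) *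
      ((p ξ : ℝ) : ℂ) * FT3 φ ξ‖ₑ ≤ ‖c‖ₑ * ∫⁻ v, ‖Ψ v‖ₑ * ‖lowFreq p φ (x + v.2)‖ₑ := by
  have hg : Integrable (fun ξ => ((p ξ : ℝ) : ℂ) * FT3 φ ξ) := by
    have hcF := continuous_FT3 hφ
    refine Continuous.integrable_of_hasCompactSupport (by fun_prop) ?_
    exact (hc.comp_left (g := fun r : ℝ => (r : ℂ)) (by simp)).mul_right
  have hI : Integrable (Function.uncurry fun (ξ : ℝ × ℝ × ℝ) (v : ℝ × ℝ × ℝ × ℝ) =>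
      Complex.exp (Complex.I * ((dot3 x ξ + dot4 v (τ, ξ) : ℝ) : ℂ)) *
        ((((p ξ : ℝ) : ℂ) * FT3 φ ξ) * Ψ v)) (volume.prod volume) := by
    refine (hg.mul_prod hΨ).bdd_mul (c := 1)
      (by unfold dot4 dot3; fun_prop : Continuous fun q : (ℝ × ℝ × ℝ) × (ℝ × ℝ × ℝ × ℝ) =>
        Complex.exp (Complex.I *
          ((dot3 x q.1 + dot4 q.2 (τ, q.1) : ℝ) : ℂ))).aestronglyMeasurable ?_
    filter_upwards with q
    rw [norm_exp_I_mul]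
  have h1 : (∫ ξ : ℝ × ℝ × ℝ, Complex.exp (Complex.I * ((dot3 x ξ + τ * omega3 ξ : ℝ) : ℂ)) *
      ((p ξ : ℝ) : ℂ) * FT3 φ ξ) = c * ∫ ξ, ∫ v,
      Complex.exp (Complex.I * ((dot3 x ξ + dot4 v (τ, ξ) : ℝ) : ℂ)) *
        ((((p ξ : ℝ) : ℂ) * FT3 φ ξ) * Ψ v) := by
    rw [← integral_const_mul]
    congr 1; ext ξ
    by_cases h0 : p ξ = 0
    · simp [h0]
    have e1 : Complex.exp (Complex.I * ((dot3 x ξ + τ * omega3 ξ : ℝ) : ℂ)) =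
        Complex.exp (Complex.I * (dot3 x ξ : ℂ)) * Φ (τ, ξ) := by
      rw [hΦ τ ξ hτ h0, ← Complex.exp_add]
      congr 1; push_cast; ring
    rw [e1, hinv, mul_left_comm, mul_assoc, mul_assoc, ← integral_const_mul, ← integral_mul_const]
    congr 2; ext v
    have e2 : Complex.exp (Complex.I * ((dot3 x ξ + dot4 v (τ, ξ) : ℝ) : ℂ)) =
        Complex.exp (Complex.I * (dot3 x ξ : ℂ)) *
          Complex.exp (Complex.I * (dot4 v (τ, ξ) : ℂ)) := by
      rw [← Complex.exp_add]
      congr 1; push_cast; ring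
    rw [e2]; ring
  have h2 : ∀ v : ℝ × ℝ × ℝ × ℝ, (∫ ξ,
      Complex.exp (Complex.I * ((dot3 x ξ + dot4 v (τ, ξ) : ℝ) : ℂ)) *
        ((((p ξ : ℝ) : ℂ) * FT3 φ ξ) * Ψ v)) =
      Complex.exp (Complex.I * ((v.1 * τ : ℝ) : ℂ)) * Ψ v * lowFreq p φ (x + v.2) := by
    intro v
    rw [lowFreq, invFT3, ← integral_const_mul]
    congr 1; ext ξ
    have e2 : Complex.exp (Complex.I * ((dot3 x ξ + dot4 v (τ, ξ) : ℝ) : ℂ)) =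
        Complex.exp (Complex.I * ((v.1 * τ : ℝ) : ℂ)) *
          Complex.exp (Complex.I * (dot3 (x + v.2) ξ : ℂ)) := by
      rw [← Complex.exp_add]
      congr 1
      simp only [dot4, dot3, Prod.fst_add, Prod.snd_add]
      push_cast; ring
    rw [e2]; ring
  rw [h1, integral_integral_swap hI, enorm_mul]
  gcongr
  refine (enorm_integral_le_lintegral_enorm _).trans (lintegral_mono fun v => ?_)
  rw [h2, enorm_mul, enorm_mul, ← ofReal_norm (Complex.exp _), norm_exp_I_mul]
  simp

lemma sq_lintegral_mul_le {α : Type*} [MeasurableSpace α] (μ : Measure α) {f g : α → ℝ≥0∞}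
    (hf : AEMeasurable f μ) (hg : AEMeasurable g μ) :
    (∫⁻ a, f a * g a ∂μ) ^ 2 ≤ (∫⁻ a, f a ^ 2 ∂μ) * ∫⁻ a, g a ^ 2 ∂μ := by
  have h := ENNReal.lintegral_mul_le_Lp_mul_Lq μ Real.HolderConjugate.two_two hf hg
  simp only [Pi.mul_apply, ENNReal.rpow_two] at h
  have hs (x : ℝ≥0∞) : (x ^ (1 / 2 : ℝ)) ^ 2 = x := by
    rw [← ENNReal.rpow_two, ← ENNReal.rpow_mul]; norm_num
  calc _ ≤ _ := pow_le_pow_left' h 2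
    _ = _ := by rw [mul_pow, hs, hs]

/-- The weight `dec` with values in `ℝ≥0∞`. -/
def edec (x : ℝ) : ℝ≥0∞ := ENNReal.ofReal (dec x)

@[fun_prop]
lemma measurable_edec : Measurable edec := continuous_dec.measurable.ennreal_ofReal

lemma edec_le_one (x : ℝ) : edec x ≤ 1 := ENNReal.ofReal_le_one.2 (dec_le_one x)

lemma lintegral_edec_ne_top : ∫⁻ x, edec x ≠ ⊤ :=
  integrable_dec.lintegral_lt_top.ne

lemma ofReal_dec3 (v : ℝ × ℝ × ℝ) :
    ENNReal.ofReal (dec3 v) = edec v.1 * (edec v.2.1 * edec v.2.2) := by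
  rw [dec3, ENNReal.ofReal_mul (dec_pos _).le, ENNReal.ofReal_mul (dec_pos _).le]; rfl

/-- The square of the `L²` norm in time and the transverse variables. -/
def mixedSq (T : ℝ) (N : ℝ × ℝ × ℝ × ℝ → ℝ≥0∞) (x : ℝ) : ℝ≥0∞ :=
  ∫⁻ s in Set.Ioc 0 T, ∫⁻ q : ℝ × ℝ, N (s, x, q) ^ 2

/-- The `L²` norm in time and the transverse variables. -/
def mixedNorm (T : ℝ) (N : ℝ × ℝ × ℝ × ℝ → ℝ≥0∞) (x : ℝ) : ℝ≥0∞ :=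
  mixedSq T N x ^ (1 / 2 : ℝ)

lemma mixedNorm_sq (T : ℝ) (N : ℝ × ℝ × ℝ × ℝ → ℝ≥0∞) (x : ℝ) :
    mixedNorm T N x ^ 2 = mixedSq T N x := by
  rw [mixedNorm, ← ENNReal.rpow_two, ← ENNReal.rpow_mul]; norm_num

lemma measurable_mixedNorm (T : ℝ) {N : ℝ × ℝ × ℝ × ℝ → ℝ≥0∞} (hN : Measurable N) :
    Measurable (mixedNorm T N) := by
  refine Measurable.pow_const ?_ _
  have h1 : Measurable fun r : ℝ × ℝ => ∫⁻ q : ℝ × ℝ, N (r.2, r.1, q) ^ 2 :=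
    Measurable.lintegral_prod_right'
      (f := fun r : (ℝ × ℝ) × (ℝ × ℝ) => N (r.1.2, r.1.1, r.2) ^ 2) (by fun_prop)
  exact h1.lintegral_prod_right'

lemma lintegral_prod_edec_mul_le (T : ℝ) (hT : T ≤ 1) {N : ℝ × ℝ × ℝ × ℝ → ℝ≥0∞}
    (hN : Measurable N) (x : ℝ) (y : ℝ × ℝ) :
    ∫⁻ s in Set.Ioc 0 T, ∫⁻ q : ℝ × ℝ, edec q.1 * edec q.2 * N (s, x, y + q) ≤
      (∫⁻ r, edec r) * mixedNorm T N x := by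
  have hm : Measurable fun r : ℝ × ℝ × ℝ => N (r.1, x, y + r.2) := by fun_prop
  have hw : Measurable fun r : ℝ × ℝ × ℝ => edec r.2.1 * edec r.2.2 := by fun_prop
  have h := sq_lintegral_mul_le ((volume.restrict (Set.Ioc 0 T)).prod volume)
    hw.aemeasurable hm.aemeasurable
  rw [lintegral_prod _ (by fun_prop), lintegral_prod _ (by fun_prop),
    lintegral_prod _ (by fun_prop)] at h
  have h1 : ∀ s, ∫⁻ q : ℝ × ℝ, N (s, x, y + q) ^ 2 = ∫⁻ q : ℝ × ℝ, N (s, x, q) ^ 2 := fun s =>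
    lintegral_add_left_eq_self (fun q : ℝ × ℝ => N (s, x, q) ^ 2) y
  simp only [h1] at h
  have h2 : ∫⁻ q : ℝ × ℝ, (edec q.1 * edec q.2) ^ 2 ≤ (∫⁻ r, edec r) ^ 2 := by
    calc _ ≤ ∫⁻ q : ℝ × ℝ, edec q.1 * edec q.2 := by
          refine lintegral_mono fun q => pow_le_of_le_one zero_le ?_ two_ne_zero
          exact mul_le_one' (edec_le_one _) (edec_le_one _)
      _ = _ := by
          rw [sq]
          exact lintegral_prod_mul measurable_edec.aemeasurable measurable_edec.aemeasurable
  have h3 : ∫⁻ _ in Set.Ioc 0 T, ∫⁻ q : ℝ × ℝ, (edec q.1 * edec q.2) ^ 2 ≤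
      (∫⁻ r, edec r) ^ 2 := by
    rw [lintegral_const, Measure.restrict_apply MeasurableSet.univ, Set.univ_inter,
      Real.volume_Ioc, sub_zero]
    exact (mul_le_of_le_one_right' (ENNReal.ofReal_le_one.2 hT)).trans h2
  rw [← ENNReal.pow_le_pow_left_iff two_ne_zero, mul_pow, mixedNorm_sq, mixedSq]
  refine h.trans ?_
  gcongr

lemma lintegral_dec3_mul_le (T : ℝ) (hT : T ≤ 1) {N : ℝ × ℝ × ℝ × ℝ → ℝ≥0∞}
    (hN : Measurable N) (x : ℝ × ℝ × ℝ) :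
    ∫⁻ s in Set.Ioc 0 T, ∫⁻ w, ENNReal.ofReal (dec3 w) * N (s, x + w) ≤
      (∫⁻ r, edec r) * ∫⁻ w, edec w * mixedNorm T N (x.1 + w) := by
  have hmN : Measurable fun r : (ℝ × ℝ) × ℝ × ℝ =>
      edec r.2.1 * edec r.2.2 * N (r.1.1, x.1 + r.1.2, x.2 + r.2) := by fun_prop
  have hmI : Measurable fun r : ℝ × ℝ => ∫⁻ q : ℝ × ℝ,
      edec q.1 * edec q.2 * N (r.1, x.1 + r.2, x.2 + q) := hmN.lintegral_prod_right'
  have h1 : ∀ s, ∫⁻ w, ENNReal.ofReal (dec3 w) * N (s, x + w) =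
      ∫⁻ u, edec u * ∫⁻ q : ℝ × ℝ, edec q.1 * edec q.2 * N (s, x.1 + u, x.2 + q) := by
    intro s
    simp only [ofReal_dec3]
    rw [Measure.volume_eq_prod, lintegral_prod _ (by fun_prop)]
    congr 1; ext u
    rw [← lintegral_const_mul _ (by fun_prop)]
    congr 1; ext q
    rw [mul_assoc]; rfl
  simp only [h1]
  rw [lintegral_lintegral_swap (by fun_prop), ← lintegral_const_mul' _ _ lintegral_edec_ne_top]
  refine lintegral_mono fun u => ?_
  rw [lintegral_const_mul _ (by fun_prop), mul_left_comm]
  gcongr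
  exact lintegral_prod_edec_mul_le T hT hN _ _

/-- Young's inequality `L² * L¹ → L²` for the weight `edec`. -/
lemma lintegral_sq_convolution_le {G : ℝ → ℝ≥0∞} (hG : Measurable G) :
    ∫⁻ x, (∫⁻ w, edec w * G (x + w)) ^ 2 ≤ (∫⁻ r, edec r) * (∫⁻ x, G x) ^ 2 := by
  have hs (x : ℝ≥0∞) : (x ^ (1 / 2 : ℝ)) ^ 2 = x := by
    rw [← ENNReal.rpow_two, ← ENNReal.rpow_mul]; norm_num
  have h1 : ∀ x, (∫⁻ w, edec w * G (x + w)) ^ 2 ≤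
      (∫⁻ w, edec w * G (x + w)) * ∫⁻ x, G x := by
    intro x
    have h := sq_lintegral_mul_le volume
      (f := fun w => edec w * G (x + w) ^ (1 / 2 : ℝ)) (g := fun w => G (x + w) ^ (1 / 2 : ℝ))
      (by fun_prop) (by fun_prop)
    simp only [mul_assoc, ← sq, mul_pow, hs] at h
    rw [lintegral_add_left_eq_self G x] at h
    refine h.trans ?_
    gcongr with w
    exact pow_le_of_le_one zero_le (edec_le_one w) two_ne_zero
  calc _ ≤ ∫⁻ x, (∫⁻ w, edec w * G (x + w)) * ∫⁻ x, G x := lintegral_mono h1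
    _ = (∫⁻ x, ∫⁻ w, edec w * G (x + w)) * ∫⁻ x, G x := by
        refine lintegral_mul_const _ (Measurable.lintegral_prod_right'
          (f := fun r : ℝ × ℝ => edec r.2 * G (r.1 + r.2)) (by fun_prop))
    _ = (∫⁻ w, ∫⁻ x, edec w * G (x + w)) * ∫⁻ x, G x := by
        rw [lintegral_lintegral_swap (by fun_prop)]
    _ = (∫⁻ w, edec w * ∫⁻ x, G x) * ∫⁻ x, G x := by
        congr 1
        congr 1; ext w
        rw [lintegral_const_mul _ (by fun_prop), lintegral_add_right_eq_self G w]
    _ = _ := by rw [lintegral_mul_const _ measurable_edec, mul_assoc, sq]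

section MixedNorm

variable {g : ℝ × ℝ × ℝ × ℝ → ℂ} {C T : ℝ}

lemma lintegral_enorm_sq_slice_le (hC : 0 ≤ C) (hb : ∀ v, ‖g v‖ ≤ C * dec3 v.2) (s x : ℝ) :
    ∫⁻ q : ℝ × ℝ, ‖g (s, x, q)‖ₑ ^ 2 ≤ (ENNReal.ofReal C * edec x) ^ 2 * (∫⁻ r, edec r) ^ 2 := by
  have h : ∀ q : ℝ × ℝ, ‖g (s, x, q)‖ₑ ^ 2 ≤
      (ENNReal.ofReal C * edec x) ^ 2 * (edec q.1 * edec q.2) := by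
    intro q
    have h1 : ‖g (s, x, q)‖ₑ ≤ ENNReal.ofReal C * edec x * (edec q.1 * edec q.2) := by
      rw [← ofReal_norm, mul_assoc, ← ofReal_dec3 (x, q), ← ENNReal.ofReal_mul hC]
      exact ENNReal.ofReal_le_ofReal (hb _)
    calc _ ≤ (ENNReal.ofReal C * edec x * (edec q.1 * edec q.2)) ^ 2 := by gcongr
      _ = (ENNReal.ofReal C * edec x) ^ 2 * (edec q.1 * edec q.2) ^ 2 := mul_pow _ _ _
      _ ≤ _ := by
        gcongr
        exact pow_le_of_le_one zero_le (mul_le_one' (edec_le_one _) (edec_le_one _)) two_ne_zero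
  calc _ ≤ ∫⁻ q : ℝ × ℝ, (ENNReal.ofReal C * edec x) ^ 2 * (edec q.1 * edec q.2) :=
        lintegral_mono h
    _ = _ := by
        rw [lintegral_const_mul _ (by fun_prop), sq (∫⁻ r, edec r)]
        congr 1
        exact lintegral_prod_mul measurable_edec.aemeasurable measurable_edec.aemeasurable

lemma sq_edec_mul_sq_lintegral_ne_top (x : ℝ) :
    (ENNReal.ofReal C * edec x) ^ 2 * (∫⁻ r, edec r) ^ 2 ≠ ⊤ :=
  ENNReal.mul_ne_top (ENNReal.pow_ne_top (ENNReal.mul_ne_top ENNReal.ofReal_ne_top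
    ENNReal.ofReal_ne_top)) (ENNReal.pow_ne_top lintegral_edec_ne_top)

lemma mixedNorm_le (hC : 0 ≤ C) (hT : T ≤ 1) (hb : ∀ v, ‖g v‖ ≤ C * dec3 v.2) (x : ℝ) :
    mixedNorm T (fun v => ‖g v‖ₑ) x ≤ ENNReal.ofReal C * edec x * ∫⁻ r, edec r := by
  rw [← ENNReal.pow_le_pow_left_iff two_ne_zero, mixedNorm_sq, mixedSq, mul_pow]
  calc _ ≤ ∫⁻ _ in Set.Ioc 0 T, (ENNReal.ofReal C * edec x) ^ 2 * (∫⁻ r, edec r) ^ 2 :=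
        lintegral_mono fun s => lintegral_enorm_sq_slice_le hC hb s x
    _ ≤ _ := by
        rw [lintegral_const, Measure.restrict_apply MeasurableSet.univ, Set.univ_inter,
          Real.volume_Ioc, sub_zero]
        exact mul_le_of_le_one_right' (ENNReal.ofReal_le_one.2 hT)

lemma mixedNorm_ne_top (hC : 0 ≤ C) (hT : T ≤ 1) (hb : ∀ v, ‖g v‖ ≤ C * dec3 v.2) (x : ℝ) :
    mixedNorm T (fun v => ‖g v‖ₑ) x ≠ ⊤ :=
  ne_top_of_le_ne_top (ENNReal.mul_ne_top (ENNReal.mul_ne_top ENNReal.ofReal_ne_top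
    ENNReal.ofReal_ne_top) lintegral_edec_ne_top) (mixedNorm_le hC hT hb x)

lemma lintegral_mixedNorm_ne_top (hC : 0 ≤ C) (hT : T ≤ 1)
    (hb : ∀ v, ‖g v‖ ≤ C * dec3 v.2) : ∫⁻ x, mixedNorm T (fun v => ‖g v‖ₑ) x ≠ ⊤ := by
  refine ne_top_of_le_ne_top ?_ (lintegral_mono (mixedNorm_le hC hT hb))
  rw [lintegral_mul_const _ (by fun_prop), lintegral_const_mul _ (by fun_prop)]
  exact ENNReal.mul_ne_top (ENNReal.mul_ne_top ENNReal.ofReal_ne_top lintegral_edec_ne_top)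
    lintegral_edec_ne_top

lemma integral_sqrt_eq_toReal (hg : Continuous g) (hC : 0 ≤ C) (hT : T ≤ 1)
    (hb : ∀ v, ‖g v‖ ≤ C * dec3 v.2) :
    ∫ x : ℝ, Real.sqrt (∫ t in Set.Ioc (0:ℝ) T, ∫ y : ℝ, ∫ z : ℝ, ‖g (t, x, y, z)‖ ^ 2) =
      (∫⁻ x, mixedNorm T (fun v => ‖g v‖ₑ) x).toReal := by
  have hfin : ∀ s x, ∫⁻ q : ℝ × ℝ, ‖g (s, x, q)‖ₑ ^ 2 < ⊤ := fun s x =>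
    (lintegral_enorm_sq_slice_le hC hb s x).trans_lt (sq_edec_mul_sq_lintegral_ne_top x).lt_top
  have henorm : ∀ v, ENNReal.ofReal (‖g v‖ ^ 2) = ‖g v‖ₑ ^ 2 := fun v => by
    rw [ENNReal.ofReal_pow (norm_nonneg _), ofReal_norm]
  have h1 : ∀ t x, ∫ y : ℝ, ∫ z : ℝ, ‖g (t, x, y, z)‖ ^ 2 =
      (∫⁻ q : ℝ × ℝ, ‖g (t, x, q)‖ₑ ^ 2).toReal := by
    intro t x
    have hm : Continuous fun q : ℝ × ℝ => ‖g (t, x, q)‖ ^ 2 := by fun_prop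
    have hint : Integrable (fun q : ℝ × ℝ => ‖g (t, x, q)‖ ^ 2) (volume.prod volume) := by
      refine ⟨hm.aestronglyMeasurable, ?_⟩
      rw [hasFiniteIntegral_iff_ofReal (ae_of_all _ fun q => by positivity)]
      simp only [henorm]
      exact hfin t x
    rw [← integral_prod (fun q : ℝ × ℝ => ‖g (t, x, q)‖ ^ 2) hint,
      integral_eq_lintegral_of_nonneg_ae (ae_of_all _ fun q => by positivity)
        hm.aestronglyMeasurable]
    simp only [henorm]
    rfl
  have h2 : ∀ x, Real.sqrt (∫ t in Set.Ioc (0:ℝ) T, ∫ y : ℝ, ∫ z : ℝ, ‖g (t, x, y, z)‖ ^ 2) =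
      (mixedNorm T (fun v => ‖g v‖ₑ) x).toReal := by
    intro x
    have hmeas : Measurable fun t => ∫⁻ q : ℝ × ℝ, ‖g (t, x, q)‖ₑ ^ 2 :=
      Measurable.lintegral_prod_right'
        (f := fun r : ℝ × ℝ × ℝ => ‖g (r.1, x, r.2)‖ₑ ^ 2)
        (Measurable.pow_const (by fun_prop :
          Continuous fun r : ℝ × ℝ × ℝ => g (r.1, x, r.2)).measurable.enorm 2)
    simp only [h1]
    rw [integral_toReal hmeas.aemeasurable (ae_of_all _ fun t => hfin t x), mixedNorm, mixedSq,
      Real.sqrt_eq_rpow, ENNReal.toReal_rpow]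
  simp only [h2]
  exact integral_toReal (measurable_mixedNorm T (by fun_prop)).aemeasurable
    (ae_of_all _ fun x => (mixedNorm_ne_top hC hT hb x).lt_top)

end MixedNorm

lemma norm_le_of_en3_lt {ξ : ℝ × ℝ × ℝ} (h : en3 ξ < 2) : ‖ξ‖ ≤ 2 := by
  have h1 : dot3 ξ ξ < 2 ^ 2 := (Real.sqrt_lt' two_pos).1 h
  unfold dot3 at h1
  simp only [Prod.norm_def, Real.norm_eq_abs, max_le_iff]
  refine ⟨?_, ?_, ?_⟩ <;> refine abs_le_of_sq_le_sq ?_ two_pos.le <;>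
    nlinarith [sq_nonneg ξ.1, sq_nonneg ξ.2.1, sq_nonneg ξ.2.2]

lemma hasCompactSupport_of_en3 {p : ℝ × ℝ × ℝ → ℝ} (hp : ∀ ξ, 2 ≤ en3 ξ → p ξ = 0) :
    HasCompactSupport p := by
  refine HasCompactSupport.of_support_subset_isCompact (isCompact_closedBall 0 2) fun ξ hξ => ?_
  rw [mem_closedBall_zero_iff]
  exact norm_le_of_en3_lt (lt_of_not_ge fun h => hξ (hp ξ h))

/-- For short times the free evolution of low frequencies is a superposition of space-time
translations with rapidly decaying density. -/
lemma exists_evolution_kernel {p : ℝ × ℝ × ℝ → ℝ} (hp : ∀ ξ, 2 ≤ en3 ξ → p ξ = 0) :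
    ∃ (Φ Ψ : ℝ × ℝ × ℝ × ℝ → ℂ) (c : ℂ) (C : ℝ), 0 ≤ C ∧ Continuous Ψ ∧
      (∀ v, ‖Ψ v‖ ≤ C * (dec v.1 * dec3 v.2)) ∧
      (∀ u, Φ u = c * ∫ v, Complex.exp (Complex.I * (dot4 v u : ℂ)) * Ψ v) ∧
      ∀ τ ξ, |τ| ≤ 1 → p ξ ≠ 0 →
        Φ (τ, ξ) = Complex.exp (Complex.I * ((τ * omega3 ξ : ℝ) : ℂ)) := by
  let χ : ContDiffBump (0 : ℝ × ℝ × ℝ × ℝ) := ⟨2, 3, two_pos, by norm_num⟩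
  let Φ : ℝ × ℝ × ℝ × ℝ → ℂ := fun u =>
    ((χ u : ℝ) : ℂ) * Complex.exp (Complex.I * ((u.1 * omega3 u.2 : ℝ) : ℂ))
  have hΦ : ContDiff ℝ (⊤ : ℕ∞) Φ := by
    have h1 : ContDiff ℝ (⊤ : ℕ∞) (fun u : ℝ × ℝ × ℝ × ℝ => u.1 * omega3 u.2) := by
      unfold omega3; fun_prop
    exact (Complex.ofRealCLM.contDiff.comp χ.contDiff).mul
      (contDiff_const.mul (Complex.ofRealCLM.contDiff.comp h1)).cexp
  have hc : HasCompactSupport Φ :=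
    (χ.hasCompactSupport.comp_left (g := fun r : ℝ => (r : ℂ)) (by simp)).mul_right
  obtain ⟨Ψ, hcont, -, ⟨C, hC, hdec⟩, c, hinv⟩ := fourier_testFunction hΦ hc
  refine ⟨Φ, Ψ, c, C, hC, hcont, fun v => (hdec v).trans ?_, hinv, fun τ ξ hτ hξ => ?_⟩
  · have h1 := dec_pos v.1
    have h2 := dec3_pos v.2
    gcongr
    exact pow_le_of_le_one (by positivity)
      (mul_le_one₀ (dec_le_one _) h2.le (dec3_le_one _)) two_ne_zero
  · have h1 : ‖ξ‖ ≤ 2 := norm_le_of_en3_lt (lt_of_not_ge fun h => hξ (hp ξ h))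
    have h2 : χ (τ, ξ) = 1 := by
      refine χ.one_of_mem_closedBall ?_
      rw [mem_closedBall_zero_iff, Prod.norm_def]
      exact max_le (by rw [Real.norm_eq_abs]; linarith) h1
    simp [Φ, h2]

/-- Pointwise bound of the low-frequency Duhamel term, uniform in time and the transverse
variables. -/
lemma exists_enorm_duhamel_le {p : ℝ × ℝ × ℝ → ℝ} (hp : Continuous p)
    (hp_zero : ∀ ξ, 2 ≤ en3 ξ → p ξ = 0) :
    ∃ K : ℝ≥0∞, K ≠ ⊤ ∧ ∀ T ≤ (1 : ℝ), ∀ f : ℝ × ℝ × ℝ × ℝ → ℂ,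
      (∀ s, Integrable fun w => f (s, w)) →
      Continuous (fun q : ℝ × ℝ × ℝ × ℝ => lowFreq p (fun w => f (q.1, w)) q.2) →
      ∀ t ∈ Set.Icc 0 T, ∀ x : ℝ × ℝ × ℝ,
        ‖duhamel (fun ξ => ((p ξ : ℝ) : ℂ)) f t x‖ₑ ≤ K * ∫⁻ w, edec w *
          mixedNorm T (fun q => ‖lowFreq p (fun w => f (q.1, w)) q.2‖ₑ) (x.1 + w) := by
  obtain ⟨Φ, Ψ, c, C, hC, hcont, hdec, hinv, hΦ⟩ := exists_evolution_kernel hp_zero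
  have hΨ : Integrable Ψ :=
    ((integrable_dec.mul_prod integrable_dec3).const_mul C).mono' hcont.aestronglyMeasurable
      (ae_of_all _ hdec)
  have hA := lintegral_edec_ne_top
  set A := ∫⁻ r, edec r
  refine ⟨‖c‖ₑ * (ENNReal.ofReal C * A) * A, by finiteness, ?_⟩
  intro T hT f hf hcg t ht x
  set N : ℝ × ℝ × ℝ × ℝ → ℝ≥0∞ := fun q => ‖lowFreq p (fun w => f (q.1, w)) q.2‖ₑ with hN
  have hNm : Measurable N := hcg.measurable.enorm
  have hslice : ∀ s, ∫⁻ v, ‖Ψ v‖ₑ * N (s, x + v.2) ≤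
      ENNReal.ofReal C * A * ∫⁻ w, ENNReal.ofReal (dec3 w) * N (s, x + w) := by
    intro s
    have hm : Measurable fun w => ENNReal.ofReal (dec3 w) * N (s, x + w) :=
      continuous_dec3.measurable.ennreal_ofReal.mul (by fun_prop)
    calc _ ≤ ∫⁻ v : ℝ × ℝ × ℝ × ℝ, (ENNReal.ofReal C * edec v.1) *
          (ENNReal.ofReal (dec3 v.2) * N (s, x + v.2)) := by
          refine lintegral_mono fun v => ?_
          rw [← mul_assoc]
          gcongr
          rw [← ofReal_norm, mul_assoc, edec, ← ENNReal.ofReal_mul (dec_pos _).le,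
            ← ENNReal.ofReal_mul hC]
          exact ENNReal.ofReal_le_ofReal (hdec v)
      _ = (∫⁻ r, ENNReal.ofReal C * edec r) *
          ∫⁻ w, ENNReal.ofReal (dec3 w) * N (s, x + w) :=
        lintegral_prod_mul (measurable_edec.const_mul _).aemeasurable hm.aemeasurable
      _ = _ := by rw [lintegral_const_mul _ (by fun_prop)]
  have hd : ‖duhamel (fun ξ => ((p ξ : ℝ) : ℂ)) f t x‖ₑ ≤
      ∫⁻ s in Set.Ioc 0 t, ‖c‖ₑ * (ENNReal.ofReal C * A) *
        ∫⁻ w, ENNReal.ofReal (dec3 w) * N (s, x + w) := by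
    rw [duhamel, intervalIntegral.integral_of_le ht.1]
    refine (enorm_integral_le_lintegral_enorm _).trans
      (setLIntegral_mono' measurableSet_Ioc fun s hs => ?_)
    have hτ : |t - s| ≤ 1 := abs_le.2 ⟨by linarith [hs.2], by linarith [hs.1, ht.2]⟩
    refine (duhamel_slice_le hp (hasCompactSupport_of_en3 hp_zero) hΨ hinv hΦ (hf s) hτ x).trans ?_
    rw [mul_assoc]
    gcongr
    exact hslice s
  refine hd.trans ?_
  calc _ ≤ ∫⁻ s in Set.Ioc 0 T, ‖c‖ₑ * (ENNReal.ofReal C * A) *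
        ∫⁻ w, ENNReal.ofReal (dec3 w) * N (s, x + w) :=
        lintegral_mono_set (Set.Ioc_subset_Ioc_right ht.2)
    _ = ‖c‖ₑ * (ENNReal.ofReal C * A) *
        ∫⁻ s in Set.Ioc 0 T, ∫⁻ w, ENNReal.ofReal (dec3 w) * N (s, x + w) :=
        lintegral_const_mul' _ _ (by finiteness)
    _ ≤ ‖c‖ₑ * (ENNReal.ofReal C * A) * (A * ∫⁻ w, edec w * mixedNorm T N (x.1 + w)) := by
        gcongr
        exact lintegral_dec3_mul_le T hT hNm x
    _ = _ := by rw [← mul_assoc]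

lemma integral_le_toReal_of_ofReal_le {h : ℝ → ℝ} {H : ℝ → ℝ≥0∞} (hh : ∀ x, 0 ≤ h x)
    (hle : ∀ x, ENNReal.ofReal (h x) ≤ H x) (hfin : ∫⁻ x, H x ≠ ⊤) :
    ∫ x, h x ≤ (∫⁻ x, H x).toReal := by
  by_cases hm : AEStronglyMeasurable h
  · rw [integral_eq_lintegral_of_nonneg_ae (ae_of_all _ hh) hm]
    exact ENNReal.toReal_mono hfin (lintegral_mono hle)
  · rw [integral_non_aestronglyMeasurable hm]
    exact ENNReal.toReal_nonneg

/-- Estimate (est-nhmax0): ‖∫₀^t U(t-t')P₀f(t')dt'‖_{L²_x L^∞_{yzT}} ≲ ‖P₀f‖_{L¹_x L²_{yzT}},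
uniformly in T ∈ (0,1]. -/
theorem duhamel_maximal_P0
    (p : ℝ × ℝ × ℝ → ℝ) (hp_smooth : ContDiff ℝ (⊤ : ℕ∞) p) (hp_nonneg : ∀ ξ, 0 ≤ p ξ)
    (hp_one : ∀ ξ, en3 ξ ≤ 1 → p ξ = 1) (hp_zero : ∀ ξ, 2 ≤ en3 ξ → p ξ = 0) :
    ∃ C : ℝ, 0 < C ∧ ∀ T : ℝ, 0 < T → T ≤ 1 → ∀ f : SchwartzMap (ℝ × ℝ × ℝ × ℝ) ℂ,
      Real.sqrt (∫ x : ℝ, (⨆ (y : ℝ) (z : ℝ) (t : Set.Icc (0:ℝ) T),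
          ‖duhamel (fun ξ => ((p ξ : ℝ) : ℂ)) (⇑f) (t : ℝ) (x, y, z)‖) ^ 2)
      ≤ C * ∫ x : ℝ, Real.sqrt (∫ t in Set.Ioc (0:ℝ) T, ∫ y : ℝ, ∫ z : ℝ,
          ‖invFT3 (fun ξ => ((p ξ : ℝ) : ℂ) * FT3 (fun w => f (t, w)) ξ) (x, y, z)‖ ^ 2) := by
  have hc := hasCompactSupport_of_en3 hp_zero
  obtain ⟨K, hK, hbound⟩ := exists_enorm_duhamel_le hp_smooth.continuous hp_zero
  set A := ∫⁻ r, edec r with hA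
  have hAtop : A ≠ ⊤ := lintegral_edec_ne_top
  set M := (K ^ 2 * A).toReal with hM
  have hM0 : 0 ≤ M := ENNReal.toReal_nonneg
  refine ⟨M + 1, by positivity, fun T hT0 hT f => ?_⟩
  obtain ⟨C₁, hC₁, hf⟩ := schwartz_decay f
  obtain ⟨hcont, C₂, hC₂, hg⟩ := lowFreq_decay hp_smooth hc f.continuous hC₁ hf
  have hsl := integrable_slice f.continuous hC₁ hf
  set g : ℝ × ℝ × ℝ × ℝ → ℂ := fun q => lowFreq p (fun w => f (q.1, w)) q.2 with hgdef
  have hg' : ∀ v, ‖g v‖ ≤ C₂ * dec3 v.2 := fun v => hg v.1 v.2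
  have hR := integral_sqrt_eq_toReal (T := T) hcont hC₂ hT hg'
  have hfin := lintegral_mixedNorm_ne_top (T := T) hC₂ hT hg'
  set G := mixedNorm T (fun v => ‖g v‖ₑ)
  have hGm : Measurable G := measurable_mixedNorm T hcont.measurable.enorm
  change _ ≤ (M + 1) * ∫ x : ℝ, Real.sqrt (∫ t in Set.Ioc (0:ℝ) T, ∫ y : ℝ, ∫ z : ℝ,
    ‖g (t, x, y, z)‖ ^ 2)
  rw [hR]
  have hpt : ∀ x y z, ∀ t : Set.Icc (0:ℝ) T,
      ‖duhamel (fun ξ => ((p ξ : ℝ) : ℂ)) (⇑f) (t : ℝ) (x, y, z)‖ₑ ≤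
        K * ∫⁻ w, edec w * G (x + w) := fun x y z t => hbound T hT f hsl hcont t t.2 (x, y, z)
  have hsup : ∀ x, ENNReal.ofReal ((⨆ (y : ℝ) (z : ℝ) (t : Set.Icc (0:ℝ) T),
      ‖duhamel (fun ξ => ((p ξ : ℝ) : ℂ)) (⇑f) (t : ℝ) (x, y, z)‖) ^ 2) ≤
      (K * ∫⁻ w, edec w * G (x + w)) ^ 2 := by
    intro x
    have h0 : 0 ≤ ⨆ (y : ℝ) (z : ℝ) (t : Set.Icc (0:ℝ) T),
        ‖duhamel (fun ξ => ((p ξ : ℝ) : ℂ)) (⇑f) (t : ℝ) (x, y, z)‖ :=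
      Real.iSup_nonneg fun y => Real.iSup_nonneg fun z => Real.iSup_nonneg fun t => norm_nonneg _
    rw [ENNReal.ofReal_pow h0]
    gcongr
    by_cases htop : K * ∫⁻ w, edec w * G (x + w) = ⊤
    · rw [htop]; exact le_top
    refine ENNReal.ofReal_le_of_le_toReal ?_
    refine Real.iSup_le (fun y => Real.iSup_le (fun z => Real.iSup_le (fun t => ?_)
      ENNReal.toReal_nonneg) ENNReal.toReal_nonneg) ENNReal.toReal_nonneg
    rw [← toReal_enorm]
    exact ENNReal.toReal_mono htop (hpt x y z t)
  have hY : ∫⁻ x, (K * ∫⁻ w, edec w * G (x + w)) ^ 2 ≤ K ^ 2 * A * (∫⁻ x, G x) ^ 2 := by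
    simp only [mul_pow]
    rw [lintegral_const_mul' _ _ (ENNReal.pow_ne_top hK), mul_assoc]
    gcongr
    exact lintegral_sq_convolution_le hGm
  have hYtop : K ^ 2 * A * (∫⁻ x, G x) ^ 2 ≠ ⊤ := by finiteness
  refine Real.sqrt_le_iff.2 ⟨by positivity, ?_⟩
  refine (integral_le_toReal_of_ofReal_le (fun x => by positivity) hsup
    (ne_top_of_le_ne_top hYtop hY)).trans ((ENNReal.toReal_mono hYtop hY).trans ?_)
  rw [ENNReal.toReal_mul, ENNReal.toReal_pow, mul_pow, ← hM]
  gcongr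
  nlinarith
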